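/- Let q be prime, k ≥ 1, let x ∈ ZMod q with x ≠ 0, and let L be a natural number with 1 ≤ L ≤ q. For g : Fin k → ZMod q define B(g) = #{ i : Fin k → ℕ | i ≠ 0, i_j < L for all j, and ∑_j i_j • g_j = x }. Then the variance of B over uniform g is at most (L^k − 1)/q. -/

import Mathlib

open Finset in
/-- A nontrivial affine equation over `ZMod q` has exactly `q ^ k / q` solutions. -/
theorem card_filter_dotProduct_eq {q k : ℕ} [Fact q.Prime] (x : ZMod q)
    {v : Fin k → ZMod q} (hv : v ≠ 0) :
    #{g : Fin k → ZMod q | v ⬝ᵥ g = x} * q = q ^ k := by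
  obtain ⟨j, hj⟩ := Function.ne_iff.mp hv
  have hj' : v j ≠ 0 := hj
  have key : #(({g : Fin k → ZMod q | v ⬝ᵥ g = x} : Finset _) ×ˢ (univ : Finset (ZMod q)))
      = #(univ : Finset (Fin k → ZMod q)) := by
    refine card_nbij' (fun p => p.1 + Pi.single j p.2)
      (fun h => (h - Pi.single j ((v ⬝ᵥ h - x) / v j), (v ⬝ᵥ h - x) / v j)) ?_ ?_ ?_ ?_
    · simp
    · intro h _
      simp [dotProduct_sub, mul_div_cancel₀ _ hj']
    · rintro ⟨g, s⟩ h
      have h' : v ⬝ᵥ g = x := by simpa using h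
      simp [dotProduct_add, h', hj']
    · intro h _
      simp
  rw [card_product] at key
  simpa [ZMod.card] using key

open Finset in
/-- Two distinct affine equations `v ⬝ᵥ g = x`, `w ⬝ᵥ g = x` with `x ≠ 0` have at most
`q ^ k / q ^ 2` common solutions. -/
theorem card_filter_dotProduct_eq_and_le {q k : ℕ} [Fact q.Prime] {x : ZMod q} (hx : x ≠ 0)
    {v w : Fin k → ZMod q} (hvw : v ≠ w) :
    #{g : Fin k → ZMod q | v ⬝ᵥ g = x ∧ w ⬝ᵥ g = x} * q ^ 2 ≤ q ^ k := by
  set N : Finset (Fin k → ZMod q) := {g | v ⬝ᵥ g = x ∧ w ⬝ᵥ g = x} with hN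
  rcases N.eq_empty_or_nonempty with h | ⟨g₀, hg₀⟩
  · simp [h]
  obtain ⟨hv₀, hw₀⟩ : v ⬝ᵥ g₀ = x ∧ w ⬝ᵥ g₀ = x := by simpa [hN] using hg₀
  obtain ⟨j, hj⟩ := Function.ne_iff.mp hvw
  have key : #(N ×ˢ (univ : Finset (ZMod q × ZMod q)))
      ≤ #(univ : Finset (Fin k → ZMod q)) := by
    refine card_le_card_of_injOn (fun p => p.1 + p.2.1 • g₀ + Pi.single j p.2.2)
      (fun _ _ => mem_coe.mpr (mem_univ _)) ?_
    rintro ⟨g, s, t⟩ hg ⟨g', s', t'⟩ hg' heq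
    obtain ⟨h1, h2⟩ : v ⬝ᵥ g = x ∧ w ⬝ᵥ g = x := by simpa [hN] using hg
    obtain ⟨h1', h2'⟩ : v ⬝ᵥ g' = x ∧ w ⬝ᵥ g' = x := by simpa [hN] using hg'
    dsimp only at heq
    have ev := congrArg (v ⬝ᵥ ·) heq
    have ew := congrArg (w ⬝ᵥ ·) heq
    simp only [dotProduct_add, dotProduct_smul, dotProduct_single, h1, h1', h2, h2', hv₀, hw₀,
      smul_eq_mul] at ev ew
    have ht : t = t' := mul_left_cancel₀ (sub_ne_zero.mpr hj) (by linear_combination ev - ew)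
    subst ht
    have hs : s = s' := mul_right_cancel₀ hx (by linear_combination ev)
    subst hs
    simpa using heq
  rw [card_product] at key
  simpa [ZMod.card, sq] using key

open Finset in
/-- Sum of squared deviations of the number of solved equations `c i ⬝ᵥ g = x`, `i ∈ I`. -/
theorem sum_sq_card_filter_sub_le {q k : ℕ} [Fact q.Prime] {x : ZMod q} (hx : x ≠ 0)
    {ι : Type*} [DecidableEq ι] (I : Finset ι) (c : ι → Fin k → ZMod q)
    (hc : Set.InjOn c I) (hc0 : ∀ i ∈ I, c i ≠ 0) :
    ∑ g, (#{i ∈ I | c i ⬝ᵥ g = x} : ℝ) = #I / q * q ^ k ∧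
    ∑ g, ((#{i ∈ I | c i ⬝ᵥ g = x} : ℝ) - #I / q) ^ 2 ≤ #I / q * q ^ k := by
  have hq : (0 : ℝ) < q := by exact_mod_cast (Fact.out : q.Prime).pos
  have h1 : ∀ i ∈ I, (#{g : Fin k → ZMod q | c i ⬝ᵥ g = x} : ℝ) = q ^ k / q := fun i hi => by
    rw [eq_div_iff hq.ne']
    exact_mod_cast card_filter_dotProduct_eq x (hc0 i hi)
  have hS : ∑ g, (#{i ∈ I | c i ⬝ᵥ g = x} : ℝ) = #I / q * q ^ k := by
    simp_rw [card_filter, Nat.cast_sum]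
    rw [sum_comm]
    simp_rw [← Nat.cast_sum, ← card_filter]
    rw [Nat.cast_sum, sum_congr rfl h1, sum_const, nsmul_eq_mul]
    ring
  have h2 : ∀ i ∈ I, ∀ j ∈ I, (#{g : Fin k → ZMod q | c i ⬝ᵥ g = x ∧ c j ⬝ᵥ g = x} : ℝ)
      ≤ q ^ k / q ^ 2 + if i = j then (q : ℝ) ^ k / q else 0 := fun i hi j hj => by
    split_ifs with hij
    · subst hij
      simp only [and_self, h1 i hi]
      linarith [show (0 : ℝ) ≤ q ^ k / q ^ 2 by positivity]
    · rw [add_zero, le_div_iff₀ (by positivity)]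
      exact_mod_cast card_filter_dotProduct_eq_and_le hx (fun h => hij (hc hi hj h))
  have hS2 : ∑ g, (#{i ∈ I | c i ⬝ᵥ g = x} : ℝ) ^ 2
      ≤ #I * (#I * (q ^ k / q ^ 2) + q ^ k / q) := by
    calc ∑ g, (#{i ∈ I | c i ⬝ᵥ g = x} : ℝ) ^ 2
        = ∑ i ∈ I, ∑ j ∈ I, (#{g : Fin k → ZMod q | c i ⬝ᵥ g = x ∧ c j ⬝ᵥ g = x} : ℝ) := by
          simp_rw [card_filter, Nat.cast_sum, sq, sum_mul_sum]
          rw [sum_comm]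
          refine sum_congr rfl fun i _ => ?_
          rw [sum_comm]
          refine sum_congr rfl fun j _ => sum_congr rfl fun g _ => ?_
          by_cases hi : c i ⬝ᵥ g = x <;> simp [hi]
      _ ≤ ∑ i ∈ I, ∑ j ∈ I, ((q : ℝ) ^ k / q ^ 2 + if i = j then (q : ℝ) ^ k / q else 0) :=
          sum_le_sum fun i hi => sum_le_sum fun j hj => h2 i hi j hj
      _ = ∑ i ∈ I, (#I * ((q : ℝ) ^ k / q ^ 2) + q ^ k / q) := by
          refine sum_congr rfl fun i hi => ?_
          rw [sum_add_distrib, sum_ite_eq, if_pos hi, sum_const, nsmul_eq_mul]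
      _ = #I * (#I * (q ^ k / q ^ 2) + q ^ k / q) := by
          rw [sum_const, nsmul_eq_mul]
  refine ⟨hS, ?_⟩
  have hexp : ∑ g, ((#{i ∈ I | c i ⬝ᵥ g = x} : ℝ) - #I / q) ^ 2
      = ∑ g, (#{i ∈ I | c i ⬝ᵥ g = x} : ℝ) ^ 2
        - 2 * (#I / q) * ∑ g, (#{i ∈ I | c i ⬝ᵥ g = x} : ℝ) + q ^ k * (#I / q) ^ 2 := by
    simp_rw [sub_sq, sum_add_distrib, sum_sub_distrib, mul_sum]
    simp [ZMod.card]
    exact sum_congr rfl fun g _ => by ring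
  rw [hexp, hS]
  have : (#I : ℝ) * (#I * (q ^ k / q ^ 2) + q ^ k / q) - 2 * (#I / q) * (#I / q * q ^ k)
      + q ^ k * (#I / q) ^ 2 = #I / q * q ^ k := by
    field_simp
    ring
  linarith


/-- Expectation of `f` under the uniform measure on a finite type `α`. -/
noncomputable def Exp (α : Type*) (f : α → ℝ) : ℝ :=
  (∑ᶠ a, f a) / (Nat.card α : ℝ)

/-- For `q` prime, `k ≥ 1`, `x ≠ 0` and `1 ≤ L ≤ q`, the variance of the number of nonzero
index vectors `i : Fin k → ℕ` with all entries `< L` satisfying `∑ j, i j • g j = x`, over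
uniform `g : Fin k → ZMod q`, is at most `(L^k - 1)/q`. -/
theorem variance_count (q k : ℕ) (hq : Nat.Prime q) (hk : 1 ≤ k)
    (x : ZMod q) (hx : x ≠ 0) (L : ℕ) (hL1 : 1 ≤ L) (hLq : L ≤ q)
    (B : (Fin k → ZMod q) → ℝ)
    (hB : ∀ g, B g = (Nat.card {i : Fin k → ℕ //
      i ≠ 0 ∧ (∀ j, i j < L) ∧ ∑ j, (i j) • g j = x} : ℝ)) :
    Exp (Fin k → ZMod q) (fun g => (B g - Exp (Fin k → ZMod q) B) ^ 2)
      ≤ ((L : ℝ) ^ k - 1) / (q : ℝ) := by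
  classical
  have : Fact q.Prime := ⟨hq⟩
  set I : Finset (Fin k → ℕ) := (Fintype.piFinset fun _ => Finset.range L).erase 0 with hI
  have memI : ∀ i, i ∈ I ↔ i ≠ 0 ∧ ∀ j, i j < L := by simp [hI]
  let c : (Fin k → ℕ) → Fin k → ZMod q := fun i j => (i j : ZMod q)
  have cast_inj : ∀ {a b : ℕ}, a < L → b < L → (a : ZMod q) = b → a = b := fun ha hb h =>
    Nat.ModEq.eq_of_lt_of_lt ((ZMod.natCast_eq_natCast_iff _ _ _).mp h)
      (ha.trans_le hLq) (hb.trans_le hLq)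
  have hc : Set.InjOn c I := fun i hi i' hi' h => funext fun j =>
    cast_inj (((memI i).mp hi).2 j) (((memI i').mp hi').2 j) (congrFun h j)
  have hc0 : ∀ i ∈ I, c i ≠ 0 := fun i hi h => ((memI i).mp hi).1 <| funext fun j =>
    cast_inj (((memI i).mp hi).2 j) hL1 (by simpa [c] using congrFun h j)
  have hcard : (I.card : ℝ) = (L : ℝ) ^ k - 1 := by
    rw [hI, Finset.card_erase_of_mem (by simp; omega), Fintype.card_piFinset_const,
      Finset.card_range, Nat.cast_sub (Nat.one_le_pow _ _ hL1)]
    simp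
  have hB' : ∀ g, B g = ((I.filter fun i => c i ⬝ᵥ g = x).card : ℝ) := fun g => by
    rw [hB, Nat.subtype_card]
    intro i
    simp [memI, c, dotProduct, nsmul_eq_mul, and_assoc]
  obtain ⟨hS, hV⟩ := sum_sq_card_filter_sub_le hx I c hc hc0
  have hq0 : (0 : ℝ) < q := by exact_mod_cast hq.pos
  have hE : ∀ f : (Fin k → ZMod q) → ℝ, Exp _ f = (∑ g, f g) / (q : ℝ) ^ k := fun f => by
    simp [Exp, finsum_eq_sum_of_fintype, ZMod.card]
  have hmean : Exp _ B = I.card / q := by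
    rw [hE, div_eq_iff (by positivity)]
    simpa only [hB'] using hS
  rw [hmean, hE, div_le_iff₀ (by positivity), ← hcard]
  simpa only [hB'] using hV
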